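/- Let v1, v2 and T be jointly distributed random variables taking values in finite sets. Let z1suf = f(v1) be a sufficient representation (I(z1suf;v2) = I(v1;v2)) and let z1min = g(v1) be a minimal sufficient representation (I(z1min;v2) = I(v1;v2) and I(z1min;v1|v2) = 0), where f and g are deterministic (measurable) functions. Then I(v1;T|v2) ≥ I(z1suf;T|v2) ≥ 0, and consequently I(v1;T) ≥ I(z1suf;T) ≥ I(z1min;T): the minimal sufficient representation contains the least task-relevant information among sufficient representations. -/

import Mathlib

open scoped BigOperators

/-- Probability that the random variable `X` (on a finite sample space `Ω`
with probability mass function `p`) takes the value `x`. -/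
noncomputable def pr {Ω S : Type*} [Fintype Ω] [DecidableEq S]
    (p : Ω → ℝ) (X : Ω → S) (x : S) : ℝ :=
  ∑ ω, if X ω = x then p ω else 0

/-- Shannon entropy (natural logarithm) of a random variable `X`. -/
noncomputable def entropy {Ω S : Type*} [Fintype Ω] [Fintype S] [DecidableEq S]
    (p : Ω → ℝ) (X : Ω → S) : ℝ :=
  -∑ x, pr p X x * Real.log (pr p X x)

/-- Conditional Shannon entropy `H(X | Y)`. -/
noncomputable def condEntropy {Ω S U : Type*} [Fintype Ω] [Fintype S] [DecidableEq S]
    [Fintype U] [DecidableEq U] (p : Ω → ℝ) (X : Ω → S) (Y : Ω → U) : ℝ :=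
  entropy p (fun ω => (X ω, Y ω)) - entropy p Y

/-- Mutual information `I(X; Y)`. -/
noncomputable def mi {Ω S U : Type*} [Fintype Ω] [Fintype S] [DecidableEq S]
    [Fintype U] [DecidableEq U] (p : Ω → ℝ) (X : Ω → S) (Y : Ω → U) : ℝ :=
  entropy p X + entropy p Y - entropy p (fun ω => (X ω, Y ω))

/-- Conditional mutual information `I(X; Y | Z)`. -/
noncomputable def cmi {Ω S U W : Type*} [Fintype Ω] [Fintype S] [DecidableEq S]
    [Fintype U] [DecidableEq U] [Fintype W] [DecidableEq W]
    (p : Ω → ℝ) (X : Ω → S) (Y : Ω → U) (Z : Ω → W) : ℝ :=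
  mi p X (fun ω => (Y ω, Z ω)) - mi p X Z

section Entropy

variable {Ω S U W : Type*} [Fintype Ω]

lemma pr_nonneg [DecidableEq S] {p : Ω → ℝ} (hp : ∀ ω, 0 ≤ p ω) (X : Ω → S) (x : S) :
    0 ≤ pr p X x :=
  Finset.sum_nonneg fun ω _ => by split_ifs <;> simp [hp ω]

lemma le_pr_apply [DecidableEq S] {p : Ω → ℝ} (hp : ∀ ω, 0 ≤ p ω) (X : Ω → S) (ω : Ω) :
    p ω ≤ pr p X (X ω) := by
  have h := Finset.single_le_sum (f := fun ω' => if X ω' = X ω then p ω' else 0)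
    (fun ω' _ => by split_ifs <;> simp [hp ω']) (Finset.mem_univ ω)
  simpa [pr] using h

lemma pr_le_pr_comp [DecidableEq S] [DecidableEq U] {p : Ω → ℝ} (hp : ∀ ω, 0 ≤ p ω)
    (X : Ω → S) (φ : S → U) (x : S) : pr p X x ≤ pr p (fun ω => φ (X ω)) (φ x) := by
  refine Finset.sum_le_sum fun ω _ => ?_
  by_cases h : X ω = x
  · simp [h]
  · rw [if_neg h]
    split_ifs <;> simp [hp ω]

lemma sum_pr_mul [Fintype S] [DecidableEq S] (p : Ω → ℝ) (X : Ω → S) (F : S → ℝ) :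
    ∑ x, pr p X x * F x = ∑ ω, p ω * F (X ω) := by
  simp only [pr, Finset.sum_mul]
  rw [Finset.sum_comm]
  simp [ite_mul]

lemma sum_pr_pair [Fintype S] [DecidableEq S] [DecidableEq U] (p : Ω → ℝ)
    (X : Ω → S) (Z : Ω → U) (z : U) :
    ∑ x, pr p (fun ω => (X ω, Z ω)) (x, z) = pr p Z z := by
  simp only [pr]
  rw [Finset.sum_comm]
  refine Finset.sum_congr rfl fun ω _ => ?_
  by_cases h : Z ω = z <;> simp [h]

lemma entropy_eq_sum [Fintype S] [DecidableEq S] (p : Ω → ℝ) (X : Ω → S) :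
    entropy p X = -∑ ω, p ω * Real.log (pr p X (X ω)) := by
  rw [entropy, sum_pr_mul]

/-- A function of a random variable has at most the entropy of that variable. -/
lemma entropy_comp_le [Fintype S] [DecidableEq S] [Fintype U] [DecidableEq U]
    {p : Ω → ℝ} (hp : ∀ ω, 0 ≤ p ω) (X : Ω → S) (φ : S → U) :
    entropy p (fun ω => φ (X ω)) ≤ entropy p X := by
  rw [entropy_eq_sum, entropy_eq_sum, neg_le_neg_iff]
  refine Finset.sum_le_sum fun ω _ => ?_
  rcases (hp ω).eq_or_lt with h | h
  · simp [← h]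
  · exact mul_le_mul_of_nonneg_left
      (Real.log_le_log (h.trans_le (le_pr_apply hp X ω)) (pr_le_pr_comp hp X φ (X ω))) h.le

/-- Relabelling the values of a random variable does not change its entropy. -/
lemma entropy_comp_eq [Fintype S] [DecidableEq S] [Fintype U] [DecidableEq U]
    {p : Ω → ℝ} (hp : ∀ ω, 0 ≤ p ω) (X : Ω → S) (φ : S → U) (ψ : U → S)
    (h : Function.LeftInverse ψ φ) :
    entropy p (fun ω => φ (X ω)) = entropy p X := by
  refine le_antisymm (entropy_comp_le hp X φ) ?_
  simpa only [h _] using entropy_comp_le hp (fun ω => φ (X ω)) ψ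

/-- Strong subadditivity of Shannon entropy. -/
lemma entropy_submodular [Fintype S] [DecidableEq S] [Fintype U] [DecidableEq U]
    [Fintype W] [DecidableEq W] {p : Ω → ℝ} (hp : ∀ ω, 0 ≤ p ω)
    (X : Ω → S) (Y : Ω → U) (Z : Ω → W) :
    entropy p (fun ω => (X ω, Y ω, Z ω)) + entropy p Z ≤
      entropy p (fun ω => (X ω, Z ω)) + entropy p (fun ω => (Y ω, Z ω)) := by
  set XYZ : Ω → S × U × W := fun ω => (X ω, Y ω, Z ω) with hXYZ
  set XZ : Ω → S × W := fun ω => (X ω, Z ω) with hXZ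
  set YZ : Ω → U × W := fun ω => (Y ω, Z ω) with hYZ
  let F : S × U × W → ℝ := fun t =>
    pr p XZ (t.1, t.2.2) * pr p YZ t.2 / (pr p XYZ t * pr p Z t.2.2)
  have key : ∑ ω, p ω * F (XYZ ω) ≤ ∑ ω, p ω := by
    rw [← sum_pr_mul]
    calc ∑ t, pr p XYZ t * F t
        ≤ ∑ t : S × U × W, pr p XZ (t.1, t.2.2) * pr p YZ t.2 / pr p Z t.2.2 := by
          refine Finset.sum_le_sum fun t _ => ?_
          rcases eq_or_ne (pr p XYZ t) 0 with h | h
          · rw [h, zero_mul]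
            exact div_nonneg (mul_nonneg (pr_nonneg hp _ _) (pr_nonneg hp _ _))
              (pr_nonneg hp _ _)
          · refine le_of_eq ?_
            simp only [F]
            rw [← mul_div_assoc, mul_div_mul_left _ _ h]
      _ = ∑ z, pr p Z z * pr p Z z / pr p Z z := by
          rw [Fintype.sum_prod_type]
          simp_rw [Fintype.sum_prod_type]
          rw [Finset.sum_congr rfl fun x _ => Finset.sum_comm, Finset.sum_comm]
          refine Finset.sum_congr rfl fun z _ => ?_
          simp only [← Finset.sum_div, ← Finset.mul_sum, ← Finset.sum_mul]
          rw [hXZ, hYZ, sum_pr_pair, sum_pr_pair]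
      _ = ∑ z, pr p Z z * 1 := by
          simp only [mul_self_div_self, mul_one]
      _ = ∑ ω, p ω := by
          rw [sum_pr_mul]
          simp
  have hterm : ∀ ω, p ω * Real.log (pr p XZ (XZ ω)) + p ω * Real.log (pr p YZ (YZ ω))
      - p ω * Real.log (pr p XYZ (XYZ ω)) - p ω * Real.log (pr p Z (Z ω))
      ≤ p ω * F (XYZ ω) - p ω := by
    intro ω
    rcases (hp ω).eq_or_lt with h | h
    · simp [← h]
    · have h1 := h.trans_le (le_pr_apply hp XZ ω)
      have h2 := h.trans_le (le_pr_apply hp YZ ω)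
      have h3 := h.trans_le (le_pr_apply hp XYZ ω)
      have h4 := h.trans_le (le_pr_apply hp Z ω)
      have hF : F (XYZ ω) =
          pr p XZ (XZ ω) * pr p YZ (YZ ω) / (pr p XYZ (XYZ ω) * pr p Z (Z ω)) := rfl
      have hlog := Real.log_le_sub_one_of_pos (div_pos (mul_pos h1 h2) (mul_pos h3 h4))
      rw [Real.log_div (mul_pos h1 h2).ne' (mul_pos h3 h4).ne', Real.log_mul h1.ne' h2.ne',
        Real.log_mul h3.ne' h4.ne', ← hF] at hlog
      have := mul_le_mul_of_nonneg_left hlog h.le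
      linarith
  have hsum := Finset.sum_le_sum fun ω (_ : ω ∈ Finset.univ) => hterm ω
  simp only [Finset.sum_sub_distrib, Finset.sum_add_distrib] at hsum
  rw [entropy_eq_sum p XYZ, entropy_eq_sum p Z, entropy_eq_sum p XZ, entropy_eq_sum p YZ]
  linarith

/-- Conditional mutual information is nonnegative. -/
lemma cmi_nonneg [Fintype S] [DecidableEq S] [Fintype U] [DecidableEq U]
    [Fintype W] [DecidableEq W] {p : Ω → ℝ} (hp : ∀ ω, 0 ≤ p ω)
    (X : Ω → S) (Y : Ω → U) (Z : Ω → W) : 0 ≤ cmi p X Y Z := by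
  have := entropy_submodular hp X Y Z
  simp only [cmi, mi]
  linarith

/-- If `H(Z | X) = 0` then `Z` carries at most as much information as `X`
about any third variable. -/
lemma mi_le_mi_of_entropy_pair_le [Fintype S] [DecidableEq S] [Fintype U] [DecidableEq U]
    [Fintype W] [DecidableEq W] {p : Ω → ℝ} (hp : ∀ ω, 0 ≤ p ω)
    (X : Ω → S) (Y : Ω → U) (Z : Ω → W)
    (h : entropy p (fun ω => (X ω, Z ω)) ≤ entropy p X) : mi p Z Y ≤ mi p X Y := by
  have h1 := entropy_submodular hp X Y Z
  have h2 := entropy_comp_le hp (fun ω => (X ω, Y ω, Z ω)) fun t => (t.1, t.2.1)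
  have h3 := entropy_comp_eq hp (fun ω => (Z ω, Y ω)) Prod.swap Prod.swap Prod.swap_swap
  simp only [Prod.swap_prod_mk] at h3
  simp only [mi]
  linarith

/-- The data processing inequality. -/
lemma mi_comp_le [Fintype S] [DecidableEq S] [Fintype U] [DecidableEq U]
    [Fintype W] [DecidableEq W] {p : Ω → ℝ} (hp : ∀ ω, 0 ≤ p ω)
    (X : Ω → S) (Y : Ω → U) (φ : S → W) : mi p (fun ω => φ (X ω)) Y ≤ mi p X Y :=
  mi_le_mi_of_entropy_pair_le hp X Y _ (entropy_comp_le hp X fun x => (x, φ x))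

end Entropy

/-- **The minimal sufficient representation contains the least task-relevant
information among sufficient representations.** If `z1suf = f ∘ v1` is
sufficient for `v2` and `z1min = g ∘ v1` is minimal sufficient for `v2`, then
`I(v1; T | v2) ≥ I(z1suf; T | v2) ≥ 0` and
`I(v1; T) ≥ I(z1suf; T) ≥ I(z1min; T)`. -/
theorem minimal_sufficient_least_task_info
    {Ω V1 V2 Z1 Z2 A : Type*} [Fintype Ω]
    [Fintype V1] [DecidableEq V1] [Nonempty V1]
    [Fintype V2] [DecidableEq V2] [Nonempty V2]
    [Fintype Z1] [DecidableEq Z1] [Nonempty Z1]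
    [Fintype Z2] [DecidableEq Z2] [Nonempty Z2]
    [Fintype A] [DecidableEq A] [Nonempty A]
    (p : Ω → ℝ) (hp : ∀ ω, 0 ≤ p ω) (hp1 : ∑ ω, p ω = 1)
    (v1 : Ω → V1) (v2 : Ω → V2) (T : Ω → A) (f : V1 → Z1) (g : V1 → Z2)
    (hsuf : mi p (fun ω => f (v1 ω)) v2 = mi p v1 v2)
    (hsufmin : mi p (fun ω => g (v1 ω)) v2 = mi p v1 v2)
    (hmin : cmi p (fun ω => g (v1 ω)) v1 v2 = 0) :
    cmi p v1 T v2 ≥ cmi p (fun ω => f (v1 ω)) T v2 ∧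
    cmi p (fun ω => f (v1 ω)) T v2 ≥ 0 ∧
    mi p v1 T ≥ mi p (fun ω => f (v1 ω)) T ∧
    mi p (fun ω => f (v1 ω)) T ≥ mi p (fun ω => g (v1 ω)) T := by
  have hdpi := mi_comp_le hp v1 (fun ω => (T ω, v2 ω)) f
  refine ⟨?_, cmi_nonneg hp _ _ _, mi_comp_le hp v1 T f,
    mi_le_mi_of_entropy_pair_le hp _ T _ ?_⟩
  · simp only [cmi]
    linarith
  · have hg := entropy_comp_eq hp (fun ω => (v1 ω, v2 ω)) (fun t => (g t.1, t.1, t.2))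
      Prod.snd fun _ => rfl
    have hfg := entropy_comp_eq hp v1 (fun x => (x, f x, g x)) Prod.fst fun _ => rfl
    have hfgw := entropy_comp_le hp (fun ω => (v1 ω, v2 ω, f (v1 ω), g (v1 ω)))
      fun t => (t.1, t.2.1)
    have hswap := entropy_comp_eq hp (fun ω => (f (v1 ω), g (v1 ω), v2 ω))
      (fun t => (t.2.2, t.1, t.2.1)) (fun t => (t.2.1, t.2.2, t.1)) fun _ => rfl
    have hsub := entropy_submodular hp v1 v2 fun ω => (f (v1 ω), g (v1 ω))
    have hsub' := entropy_submodular hp (fun ω => f (v1 ω)) (fun ω => g (v1 ω)) v2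
    simp only [cmi, mi] at hmin hsuf
    linarith
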